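/- Let (A, m) be a quasi local ring which is finite over a central Noetherian subring R. Then the m-adic filtration on A satisfies the strong closure condition; in particular, for any finitely many elements a₁, …, a_s of A and any nonnegative integers i₁, …, i_s, the left A-submodule m^{i₁}·a₁ + ⋯ + m^{i_s}·a_s of A is closed in the m-adic topology, i.e. ⋂_{k ≥ 0} ( m^{i₁}·a₁ + ⋯ + m^{i_s}·a_s + m^k ) = m^{i₁}·a₁ + ⋯ + m^{i_s}·a_s, where m^{i}·a denotes the additive subgroup { x·a : x ∈ m^{i} }. -/

import Mathlib

/-- For a two-sided ideal `I` of `A` and a left `A`-module `M`, the submodule `I • M`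
of `M` generated by the products `a • y` with `a ∈ I`, `y ∈ M`. -/
def idealSmulSpan {A : Type*} [Ring A] (I : TwoSidedIdeal A)
    (M : Type*) [AddCommGroup M] [Module A M] : Submodule A M :=
  Submodule.span A {x : M | ∃ a ∈ I, ∃ y : M, a • y = x}

/-- The `k`-th power of a two-sided ideal: `m^0 = A` and
`m^{k+1}` is the two-sided ideal generated by products `a * b`, `a ∈ m`, `b ∈ m^k`. -/
def tsiPow {A : Type*} [Ring A] (m : TwoSidedIdeal A) : ℕ → TwoSidedIdeal A
  | 0 => ⊤
  | k + 1 => TwoSidedIdeal.span {x : A | ∃ a ∈ m, ∃ b ∈ tsiPow m k, x = a * b}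

section FiniteAlgebra

universe u

open TwoSidedIdeal

/-- A two-sided ideal of an `R`-algebra, as an `R`-submodule. -/
def TwoSidedIdeal.toSubmodule (R : Type*) {A : Type*} [CommRing R] [Ring A] [Algebra R A]
    (I : TwoSidedIdeal A) : Submodule R A :=
  I.asIdeal.restrictScalars R

section

variable {R A : Type*} [CommRing R] [Ring A] [Algebra R A] (m : TwoSidedIdeal A)

theorem TwoSidedIdeal.mem_toSubmodule {I : TwoSidedIdeal A} {x : A} :
    x ∈ I.toSubmodule R ↔ x ∈ I := by
  simp [TwoSidedIdeal.toSubmodule]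

theorem toSubmodule_tsiPow_succ (k : ℕ) :
    (tsiPow m (k + 1)).toSubmodule R = m.toSubmodule R * (tsiPow m k).toSubmodule R := by
  apply le_antisymm
  · intro x hx
    rw [mem_toSubmodule, tsiPow, mem_span_iff_mem_addSubgroup_closure_absorbing] at hx
    · induction hx using AddSubgroup.closure_induction with
      | mem x hx =>
        obtain ⟨a, ha, b, hb, rfl⟩ := hx
        exact Submodule.mul_mem_mul (mem_toSubmodule.2 ha) (mem_toSubmodule.2 hb)
      | zero => exact zero_mem _
      | add x y _ _ hx hy => exact add_mem hx hy
      | neg x _ hx => exact neg_mem hx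
    · rintro x _ ⟨a, ha, b, hb, rfl⟩
      exact ⟨x * a, m.mul_mem_left x a ha, b, hb, (mul_assoc _ _ _).symm⟩
    · rintro _ x ⟨a, ha, b, hb, rfl⟩
      exact ⟨a, ha, b * x, (tsiPow m k).mul_mem_right b x hb, mul_assoc _ _ _⟩
  · rw [Submodule.mul_le]
    intro a ha b hb
    rw [mem_toSubmodule] at *
    exact subset_span ⟨a, ha, b, hb, rfl⟩

theorem toSubmodule_tsiPow (k : ℕ) :
    (tsiPow m k).toSubmodule R = m.toSubmodule R ^ k * ⊤ := by
  induction k with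
  | zero => ext x; simp [mem_toSubmodule, tsiPow]
  | succ k ih => rw [toSubmodule_tsiPow_succ, ih, pow_succ', mul_assoc]

theorem tsiPow_antitone : Antitone (tsiPow m) := by
  refine antitone_nat_of_succ_le fun k => ?_
  rw [tsiPow, span_le]
  rintro _ ⟨a, -, b, hb, rfl⟩
  exact (tsiPow m k).mul_mem_left a b hb

theorem smul_top_pow_le (P : Ideal R) (k : ℕ) :
    (P • (⊤ : Submodule R A)) ^ k * ⊤ ≤ P ^ k • (⊤ : Submodule R A) := by
  induction k with
  | zero => simp
  | succ k ih =>
    rw [pow_succ', mul_assoc]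
    refine (mul_le_mul' le_rfl ih).trans ?_
    rw [Submodule.mul_le]
    intro a ha b hb
    induction ha using Submodule.smul_induction_on' with
    | smul r hr a _ =>
      rw [pow_succ', mul_smul, smul_mul_assoc]
      refine Submodule.smul_mem_smul hr ?_
      exact Submodule.smul_top_le_comap_smul_top _ (LinearMap.mulLeft R a) hb
    | add x _ y _ hx hy => rw [add_mul]; exact add_mem hx hy

end

/-- A maximal two-sided ideal of an algebra contracts to a maximal ideal of the base ring when the
algebra is finite. -/
theorem isMaximal_comap_asIdeal {R A : Type*} [CommRing R] [Ring A] [Algebra R A]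
    [Module.Finite R A] (m : TwoSidedIdeal A) (hmax : IsCoatom m) :
    (m.asIdeal.comap (algebraMap R A)).IsMaximal := by
  rw [Ideal.isMaximal_iff]
  constructor
  · intro h
    rw [Ideal.mem_comap, map_one, mem_asIdeal] at h
    exact hmax.1 (m.one_mem_iff.1 h)
  · intro J r hJ hr hrJ
    let K : TwoSidedIdeal A := .mk' {x | ∃ a, x - r • a ∈ m} ⟨0, by simp [m.zero_mem]⟩
      (by
        rintro x y ⟨a, ha⟩ ⟨b, hb⟩
        exact ⟨a + b, by simpa [smul_add, add_sub_add_comm] using m.add_mem ha hb⟩)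
      (by
        rintro x ⟨a, ha⟩
        exact ⟨-a, by simpa [smul_neg, sub_eq_add_neg, add_comm] using m.neg_mem ha⟩)
      (by
        rintro x y ⟨a, ha⟩
        exact ⟨x * a, by simpa [mul_sub] using m.mul_mem_left x _ ha⟩)
      (by
        rintro x y ⟨a, ha⟩
        exact ⟨a * y, by simpa [sub_mul] using m.mul_mem_right _ y ha⟩)
    have hmK : m < K := by
      refine lt_of_le_of_ne (fun x hx => ?_) fun h => hr ?_
      · exact (mem_mk' ..).2 ⟨0, by simpa using hx⟩
      · rw [Ideal.mem_comap, mem_asIdeal, h]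
        refine (mem_mk' ..).2 ⟨1, ?_⟩
        simp [Algebra.smul_def, m.zero_mem]
    obtain ⟨a, ha⟩ : ∃ a, 1 - r • a ∈ m := by
      have h1 : (1 : A) ∈ K := by rw [hmax.2 K hmK]; trivial
      simpa only [K, mem_mk', Set.mem_ofPred_eq] using h1
    let M := A ⧸ m.asIdeal.restrictScalars R
    obtain ⟨t, ht, ht'⟩ := Submodule.exists_sub_one_mem_and_smul_eq_zero_of_fg_of_le_smul
      (Ideal.span {r}) (⊤ : Submodule R M) Module.Finite.fg_top (by
        intro z _
        obtain ⟨b, rfl⟩ := Submodule.Quotient.mk_surjective _ z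
        have hb : (Submodule.Quotient.mk b : M) = r • Submodule.Quotient.mk (a * b) := by
          refine (Submodule.Quotient.eq _).2 ?_
          simpa [sub_mul] using m.mul_mem_right _ b ha
        rw [hb]
        exact Submodule.smul_mem_smul (Ideal.mem_span_singleton_self r) trivial)
    have htm : t ∈ m.asIdeal.comap (algebraMap R A) := by
      have := ht' (Submodule.Quotient.mk 1) trivial
      rw [← Submodule.Quotient.mk_smul, Submodule.Quotient.mk_eq_zero] at this
      simpa [Algebra.smul_def] using this
    have h1 : t - 1 ∈ J := (Ideal.span_singleton_le_iff_mem J).2 hrJ ht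
    simpa using J.sub_mem (hJ htm) h1

/-- A power of `m` lies in the extension of its contraction to the base ring. -/
theorem exists_tsiPow_le_smul_top {R : Type*} {A : Type u} [CommRing R] [IsNoetherianRing R]
    [Ring A] [Algebra R A] [Module.Finite R A] (m : TwoSidedIdeal A) (hmax : IsCoatom m)
    (hNAK : ∀ (M : Type u) [AddCommGroup M] [Module A M], Module.Finite A M →
      idealSmulSpan m M = ⊤ → Subsingleton M) :
    ∃ n, (tsiPow m n).toSubmodule R ≤ m.asIdeal.comap (algebraMap R A) • ⊤ := by
  set P := m.asIdeal.comap (algebraMap R A)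
  have := isMaximal_comap_asIdeal (R := R) m hmax
  let _ := Ideal.Quotient.field P
  have : IsArtinian (R ⧸ P) (A ⧸ P • (⊤ : Submodule R A)) :=
    have : Module.Finite (R ⧸ P) (A ⧸ P • (⊤ : Submodule R A)) := .of_restrictScalars_finite R _ _
    inferInstance
  have : IsArtinian R (A ⧸ P • (⊤ : Submodule R A)) :=
    isArtinian_of_surjective_algebraMap (R := R ⧸ P) Ideal.Quotient.mk_surjective
  obtain ⟨n, hn⟩ := IsArtinian.monotone_stabilizes (R := R) (M := A ⧸ P • (⊤ : Submodule R A))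
    ⟨fun k => OrderDual.toDual (((tsiPow m k).toSubmodule R).map (Submodule.mkQ _)), fun j k h =>
      Submodule.map_mono fun x hx => mem_toSubmodule.2 (tsiPow_antitone m h (mem_toSubmodule.1 hx))⟩
  refine ⟨n, ?_⟩
  let W : Submodule A A :=
    { (P • (⊤ : Submodule R A)).toAddSubmonoid with
      smul_mem' := fun a x hx =>
        Submodule.smul_top_le_comap_smul_top _ (LinearMap.mulLeft R a) hx }
  have : IsNoetherian A A := isNoetherian_of_tower R inferInstance
  let N : Submodule A (A ⧸ W) := Submodule.map W.mkQ (tsiPow m n).asIdeal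
  have hN : Subsingleton N := by
    refine hNAK N inferInstance ?_
    rw [← (Submodule.map_injective_of_injective N.injective_subtype).eq_iff, Submodule.map_top,
      Submodule.range_subtype]
    refine le_antisymm (by rintro _ ⟨y, -, rfl⟩; exact y.2) ?_
    rintro _ ⟨x, hx, rfl⟩
    have hx' : Submodule.mkQ (P • (⊤ : Submodule R A)) x ∈
        ((tsiPow m (n + 1)).toSubmodule R).map (Submodule.mkQ (P • (⊤ : Submodule R A))) := by
      rw [← OrderDual.toDual_inj.1 (hn (n + 1) n.le_succ)]
      exact ⟨x, hx, rfl⟩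
    obtain ⟨w, hw, hwx⟩ := hx'
    have hwx' : W.mkQ w = W.mkQ x :=
      (Submodule.Quotient.eq W).2 ((Submodule.Quotient.eq _).1 hwx)
    rw [← hwx']
    rw [SetLike.mem_coe, toSubmodule_tsiPow_succ] at hw
    clear hwx' hwx
    induction hw using Submodule.mul_induction_on' with
    | mem_mul_mem a ha b hb =>
      refine ⟨a • ⟨W.mkQ b, b, hb, rfl⟩, ?_, rfl⟩
      exact Submodule.subset_span ⟨a, mem_toSubmodule.1 ha, _, rfl⟩
    | add x _ y _ hx hy => rw [map_add]; exact add_mem hx hy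
  intro x hx
  have h : (⟨W.mkQ x, x, hx, rfl⟩ : N) = 0 := Subsingleton.elim _ _
  exact (Submodule.Quotient.mk_eq_zero W).1 (congrArg Subtype.val h)

/-- Every left ideal is closed in the `m`-adic topology. -/
theorem mem_of_forall_exists_add_tsiPow (R : Type*) {A : Type u} [CommRing R] [IsNoetherianRing R]
    [Ring A] [Algebra R A] [Module.Finite R A] (m : TwoSidedIdeal A) (hmax : IsCoatom m)
    (hNAK : ∀ (M : Type u) [AddCommGroup M] [Module A M], Module.Finite A M →
      idealSmulSpan m M = ⊤ → Subsingleton M)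
    (T : Submodule A A) (x : A) (hx : ∀ k, ∃ y ∈ tsiPow m k, x - y ∈ T) : x ∈ T := by
  obtain ⟨n, hn⟩ := exists_tsiPow_le_smul_top (R := R) m hmax hNAK
  set P := m.asIdeal.comap (algebraMap R A)
  have hpow (k : ℕ) : (tsiPow m (n * k)).toSubmodule R ≤ P ^ k • ⊤ := by
    rw [toSubmodule_tsiPow, pow_mul]
    refine le_trans (mul_le_mul' (pow_le_pow_left' ?_ k) le_rfl) (smul_top_pow_le P k)
    refine le_trans ?_ hn
    rw [toSubmodule_tsiPow]
    nth_rewrite 1 [← mul_one (m.toSubmodule R ^ n)]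
    exact mul_le_mul' le_rfl le_top
  have hkrull : T.mkQ x ∈ (⨅ k : ℕ, P ^ k • ⊤ : Submodule R (A ⧸ T)) := by
    rw [Submodule.mem_iInf]
    intro k
    obtain ⟨y, hy, hxy⟩ := hx (n * k)
    rw [show T.mkQ x = T.mkQ y from (Submodule.Quotient.eq T).2 hxy]
    exact Submodule.smul_top_le_comap_smul_top _ (T.mkQ.restrictScalars R)
      (hpow k (mem_toSubmodule.2 hy))
  have : Module.Finite R (A ⧸ T) :=
    Module.Finite.of_surjective (T.mkQ.restrictScalars R) T.mkQ_surjective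
  obtain ⟨⟨r, hr⟩, hrx⟩ := (P.mem_iInf_smul_pow_eq_bot_iff _).1 hkrull
  let N : Submodule A (A ⧸ T) := Submodule.span A {T.mkQ x}
  have hN : Subsingleton N := by
    refine hNAK N inferInstance (Submodule.eq_top_iff'.2 fun ⟨z, hz⟩ => ?_)
    refine Submodule.subset_span ⟨algebraMap R A r, hr, ⟨z, hz⟩, Subtype.ext ?_⟩
    obtain ⟨a, rfl⟩ := Submodule.mem_span_singleton.1 hz
    rw [Submodule.coe_smul, algebraMap_smul, smul_comm, hrx]
  have h : (⟨T.mkQ x, Submodule.mem_span_singleton_self _⟩ : N) = 0 := Subsingleton.elim _ _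
  exact (Submodule.Quotient.mk_eq_zero T).1 (congrArg Subtype.val h)

end FiniteAlgebra

/-- Let `(A, m)` be a quasi local ring (demi local, Nakayama's lemma
holds for `(A, m)`, `A/m` simple Artinian) which is finite over a central Noetherian
subring `R`.  Then the `m`-adic filtration satisfies the strong closure condition: for
any `a₁, …, a_s ∈ A` and exponents `i₁, …, i_s`, the left submodule
`T = m^{i₁}·a₁ + ⋯ + m^{i_s}·a_s` is closed in the `m`-adic topology, i.e.
`⋂_{k ≥ 0} (T + m^k) = T`. -/
theorem quasiLocal_strong_closure_condition.{u} {A : Type u} [Ring A]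
    (m : TwoSidedIdeal A)
    (hmax : IsCoatom m) (huniq : ∀ m' : TwoSidedIdeal A, IsCoatom m' → m' = m)
    (hNAK : ∀ (M : Type u) [AddCommGroup M] [Module A M], Module.Finite A M →
      idealSmulSpan m M = ⊤ → Subsingleton M)
    (hSA : IsSimpleRing m.ringCon.Quotient ∧ IsArtinianRing m.ringCon.Quotient)
    (R : Subring A) (hcent : ∀ r ∈ R, ∀ a : A, r * a = a * r)
    [IsNoetherianRing R] [Module.Finite R A]
    (s : ℕ) (a : Fin s → A) (i : Fin s → ℕ) :
    {x : A | ∀ k : ℕ, ∃ (c : Fin s → A) (y : A),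
        (∀ j, c j ∈ tsiPow m (i j)) ∧ y ∈ tsiPow m k ∧
        x = (∑ j, c j * a j) + y} =
      {x : A | ∃ c : Fin s → A, (∀ j, c j ∈ tsiPow m (i j)) ∧ x = ∑ j, c j * a j} := by
  let _ : CommRing R :=
    { (inferInstance : Ring R) with mul_comm := fun r t => Subtype.ext (hcent r r.2 t) }
  let _ : Algebra R A :=
    { algebraMap := R.subtype
      commutes' := fun r x => hcent r r.2 x
      smul_def' := fun _ _ => rfl }
  ext x
  constructor
  · intro hx
    let T : Submodule A A :=
      { carrier := {x : A | ∃ c : Fin s → A, (∀ j, c j ∈ tsiPow m (i j)) ∧ x = ∑ j, c j * a j}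
        add_mem' := by
          rintro _ _ ⟨c, hc, rfl⟩ ⟨d, hd, rfl⟩
          exact ⟨c + d, fun j => add_mem (hc j) (hd j), by
            simp [add_mul, Finset.sum_add_distrib]⟩
        zero_mem' := ⟨0, fun j => zero_mem _, by simp⟩
        smul_mem' := by
          rintro b _ ⟨c, hc, rfl⟩
          exact ⟨fun j => b * c j, fun j => (tsiPow m (i j)).mul_mem_left _ _ (hc j), by
            simp [Finset.mul_sum, mul_assoc]⟩ }
    refine mem_of_forall_exists_add_tsiPow R m hmax hNAK T x fun k => ?_
    obtain ⟨c, y, hc, hy, rfl⟩ := hx k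
    exact ⟨y, hy, c, hc, add_sub_cancel_right _ _⟩
  · rintro ⟨c, hc, rfl⟩ k
    exact ⟨c, 0, hc, zero_mem _, (add_zero _).symm⟩
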